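/- Let Ω be a finite state space, A a finite nonempty action set, and ρ a max-affine risk value with finite nonempty index sets L_a and coefficient vectors c_{a,ℓ} : Ω → ℝ. Fix a set U of probability vectors on Ω, η ≥ 0, and let U^η := { ν : ν is a probability vector with inf_{μ' ∈ U} Σ_ω |ν(ω) − μ'(ω)| ≤ η }. Let F_loc := { (a,ℓ) : a ∈ A, ℓ ∈ L_a, and there exists ν ∈ U^η with ρ(ν,a) = Σ_ω c_{a,ℓ}(ω)ν(ω) }. If μ ∈ U, μ̄ ∈ U^η, ε ≥ 0, and |Σ_ω c_{a,ℓ}(ω)·(μ̄(ω) − μ(ω))| ≤ ε for every (a,ℓ) ∈ F_loc, then |ρ(μ̄,a) − ρ(μ,a)| ≤ ε for every action a ∈ A. -/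

import Mathlib

open Finset

/-- A probability vector on a finite type. -/
def IsProbVec {Ω : Type*} [Fintype Ω] (μ : Ω → ℝ) : Prop :=
  (∀ ω, 0 ≤ μ ω) ∧ ∑ ω, μ ω = 1

/-- The receiver's max-affine risk value. -/
noncomputable def maxAffine {Ω A : Type*} [Fintype Ω] {L : A → Type*} [∀ a, Fintype (L a)]
    [∀ a, Nonempty (L a)] (c : (a : A) → L a → Ω → ℝ) (μ : Ω → ℝ) (a : A) : ℝ :=
  Finset.univ.sup' Finset.univ_nonempty fun ℓ : L a => ∑ ω, c a ℓ ω * μ ω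

/-- The `η`-enlargement `U^η` of a set `U` of beliefs: probability vectors whose
ℓ¹-distance to `U` is at most `η`. -/
noncomputable def enlargement {Ω : Type*} [Fintype Ω] (U : Set (Ω → ℝ)) (η : ℝ) :
    Set (Ω → ℝ) :=
  {ν | IsProbVec ν ∧ sInf ((fun μ' => ∑ ω, |ν ω - μ' ω|) '' U) ≤ η}

/-- A set of probability vectors is contained in its enlargements. -/
theorem mem_enlargement_of_mem {Ω : Type*} [Fintype Ω] {U : Set (Ω → ℝ)}
    (hU : ∀ μ' ∈ U, IsProbVec μ') {η : ℝ} (hη : 0 ≤ η) {μ : Ω → ℝ} (hμ : μ ∈ U) :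
    μ ∈ enlargement U η := by
  refine ⟨hU μ hμ, (csInf_le ⟨0, ?_⟩ (Set.mem_image_of_mem _ hμ)).trans (by simpa using hη)⟩
  rintro _ ⟨μ', -, rfl⟩
  exact Finset.sum_nonneg fun ω _ => abs_nonneg _

section maxAffine

variable {Ω A : Type*} [Fintype Ω] {L : A → Type*} [∀ a, Fintype (L a)] [∀ a, Nonempty (L a)]

theorem facet_le_maxAffine (c : (a : A) → L a → Ω → ℝ) (μ : Ω → ℝ) (a : A) (ℓ : L a) :
    ∑ ω, c a ℓ ω * μ ω ≤ maxAffine c μ a :=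
  Finset.le_sup' (fun ℓ : L a => ∑ ω, c a ℓ ω * μ ω) (Finset.mem_univ ℓ)

theorem exists_active_facet (c : (a : A) → L a → Ω → ℝ) (μ : Ω → ℝ) (a : A) :
    ∃ ℓ : L a, maxAffine c μ a = ∑ ω, c a ℓ ω * μ ω := by
  obtain ⟨ℓ, -, hℓ⟩ := Finset.exists_mem_eq_sup' Finset.univ_nonempty
    fun ℓ : L a => ∑ ω, c a ℓ ω * μ ω
  exact ⟨ℓ, hℓ⟩

end maxAffine

/-- **Local active-facet proxy.** Let `F_loc` be the set of action–facet pairs `(a,ℓ)`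
active at some belief of `U^η`.  If `μ ∈ U`, `μ̄ ∈ U^η`, and `μ̄` matches `μ` up to `ε`
on every locally active facet, then every action's max-affine risk value at `μ̄` matches
its value at `μ` up to `ε`. -/
theorem local_active_facet_proxy
    (Ω A : Type*) [Fintype Ω] [Fintype A] [Nonempty A]
    (L : A → Type*) [∀ a, Fintype (L a)] [∀ a, Nonempty (L a)]
    (c : (a : A) → L a → Ω → ℝ)
    (U : Set ((Ω → ℝ))) (hU : ∀ μ' ∈ U, IsProbVec μ')
    (η : ℝ) (hη : 0 ≤ η)
    (μ μbar : Ω → ℝ) (hμU : μ ∈ U) (hμbar : μbar ∈ enlargement U η)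
    (ε : ℝ) (hε : 0 ≤ ε)
    (hFloc : ∀ (a : A) (ℓ : L a),
      (∃ ν ∈ enlargement U η, maxAffine c ν a = ∑ ω, c a ℓ ω * ν ω) →
      |∑ ω, c a ℓ ω * (μbar ω - μ ω)| ≤ ε) :
    ∀ a : A, |maxAffine c μbar a - maxAffine c μ a| ≤ ε := by
  have hμ : μ ∈ enlargement U η := mem_enlargement_of_mem hU hη hμU
  intro a
  obtain ⟨ℓ, hℓ⟩ := exists_active_facet c μ a
  obtain ⟨ℓbar, hℓbar⟩ := exists_active_facet c μbar a
  have h := abs_le.mp (hFloc a ℓ ⟨μ, hμ, hℓ⟩)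
  have hbar := abs_le.mp (hFloc a ℓbar ⟨μbar, hμbar, hℓbar⟩)
  have hle := facet_le_maxAffine c μbar a ℓ
  have hlebar := facet_le_maxAffine c μ a ℓbar
  simp only [mul_sub, Finset.sum_sub_distrib] at h hbar
  rw [abs_le]
  constructor <;> linarith
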